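/- arXiv:0712.1932 — 2 statements merged into one kernel-verified Lean document; each statement's English description precedes it below -/
import Mathlib

section
/- Let R be a commutative ring, let A be an n × n matrix over R with n ≥ 4 (indices viewed in {1, …, n}), let i < j be two row indices and k < l < s < r four column indices. For column indices p < q, let m(p,q) denote the determinant of the (n − 2) × (n − 2) submatrix of A obtained by deleting rows i and j and columns p and q. Then m(k,l)·m(s,r) − m(k,s)·m(l,r) + m(k,r)·m(l,s) = 0. -/
/-- The determinant of the `(n - 2) × (n - 2)` submatrix of `A` obtained by deleting
rows `i`, `j` and columns `p`, `q` (remaining rows and columns in increasing order). -/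
noncomputable def complMinor2 {R : Type*} [CommRing R] {n : ℕ}
    (A : Matrix (Fin n) (Fin n) R) (i j p q : Fin n) (hij : i ≠ j) (hpq : p ≠ q) : R :=
  Matrix.det (A.submatrix
    (fun t : Fin (n - 2) => ({i, j}ᶜ : Finset (Fin n)).orderEmbOfFin
      (by rw [Finset.card_compl, Finset.card_pair hij, Fintype.card_fin]) t)
    (fun t : Fin (n - 2) => ({p, q}ᶜ : Finset (Fin n)).orderEmbOfFin
      (by rw [Finset.card_compl, Finset.card_pair hpq, Fintype.card_fin]) t))

namespace Matrix

variable {R m : Type*} [CommRing R] [Fintype m] [DecidableEq m]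

theorem det_updateRow_updateRow_swap (A : Matrix m m R) {i j : m} (hij : i ≠ j) (x y : m → R) :
    ((A.updateRow i x).updateRow j y).det = -((A.updateRow i y).updateRow j x).det := by
  have h : ((A.updateRow i x).updateRow j y) =
      ((A.updateRow i y).updateRow j x).submatrix (Equiv.swap i j) id := by
    ext a b
    simp only [submatrix_apply, updateRow_apply, Equiv.swap_apply_def, id]
    grind
  rw [h, det_permute, Equiv.Perm.sign_swap hij]
  simp

theorem det_updateRow_updateRow_mul (A : Matrix m m R) {i j : m} (hij : i ≠ j)
    (w x y z : m → R) :
    ((A.updateRow i w).updateRow j x).det * ((A.updateRow i y).updateRow j z).det =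
      ((A.updateRow i y).updateRow j x).det * ((A.updateRow i w).updateRow j z).det +
      ((A.updateRow i w).updateRow j y).det * ((A.updateRow i x).updateRow j z).det := by
  set C := (A.updateRow i w).updateRow j x with hC
  let L : (m → R) →ₗ[R] R := LinearMap.proj i ∘ₗ cramer (A.updateRow j z)ᵀ
  have hL (b : m → R) : L b = ((A.updateRow i b).updateRow j z).det := by
    simp only [L, LinearMap.comp_apply, LinearMap.proj_apply, cramer_transpose_apply]
    congr 1
    exact Function.update_comm hij.symm _ _ _
  have key := congrArg L (mulVec_cramer Cᵀ y)
  rw [mulVec_eq_sum, map_sum, map_smul, hL, det_transpose, smul_eq_mul] at key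
  simp only [op_smul_eq_smul, map_smul, transpose_transpose, smul_eq_mul] at key
  rw [← key, Fintype.sum_eq_add i j hij]
  · have hi : C i = w := by rw [hC, updateRow_ne hij, updateRow_self]
    have hj : C j = x := by rw [hC, updateRow_self]
    have hCi : C.updateRow i y = (A.updateRow i y).updateRow j x := by
      ext a b
      simp only [hC, updateRow_apply]
      grind
    have hCj : C.updateRow j y = (A.updateRow i w).updateRow j y := by
      ext a b
      simp only [hC, updateRow_apply]
      grind
    simp [cramer_transpose_apply, hL, hi, hj, hCi, hCj]
  · rintro t ⟨hti, htj⟩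
    have ht : C t = A t := by rw [hC, updateRow_ne htj, updateRow_ne hti]
    have h0 : L (C t) = 0 := by
      rw [hL, ht]
      refine det_zero_of_row_eq hti ?_
      rw [updateRow_ne htj, updateRow_ne hti, updateRow_ne hij, updateRow_self]
    simp [h0]

theorem det_updateRow_single_one {n : ℕ} (A : Matrix (Fin (n + 1)) (Fin (n + 1)) R)
    (i p : Fin (n + 1)) :
    (A.updateRow i (Pi.single p 1)).det =
      (-1) ^ (i + p : ℕ) * (A.submatrix i.succAbove p.succAbove).det := by
  rw [← adjugate_apply, adjugate_fin_succ_eq_det_submatrix]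

end Matrix

theorem Finset.orderEmbOfFin_compl_pair {n : ℕ} (j : Fin (n + 2)) (i : Fin (n + 1))
    (h : (({j.succAbove i, j}ᶜ : Finset (Fin (n + 2)))).card = n) :
    (({j.succAbove i, j}ᶜ : Finset (Fin (n + 2))).orderEmbOfFin h : Fin n → Fin (n + 2)) =
      j.succAbove ∘ i.succAbove := by
  symm
  refine Finset.orderEmbOfFin_unique h (fun t => ?_)
    ((Fin.strictMono_succAbove j).comp (Fin.strictMono_succAbove i))
  simp [Fin.succAbove_ne]

theorem det_updateRow_single_updateRow_single {R : Type*} [CommRing R] {n : ℕ}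
    (A : Matrix (Fin n) (Fin n) R) {i j p q : Fin n} (hij : i < j) (hpq : p < q) :
    ((A.updateRow i (Pi.single p 1)).updateRow j (Pi.single q 1)).det =
      (-1) ^ (i + j + p + q : ℕ) * complMinor2 A i j p q hij.ne hpq.ne := by
  obtain _ | _ | n := n
  · exact i.elim0
  · omega
  obtain ⟨i', rfl⟩ := Fin.exists_succAbove_eq hij.ne
  obtain ⟨p', rfl⟩ := Fin.exists_succAbove_eq hpq.ne
  have hi : (j.succAbove i' : ℕ) = i' := by
    rw [Fin.succAbove_of_castSucc_lt _ _ ((Fin.succAbove_lt_iff_castSucc_lt _ _).1 hij),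
      Fin.val_castSucc]
  have hp : (q.succAbove p' : ℕ) = p' := by
    rw [Fin.succAbove_of_castSucc_lt _ _ ((Fin.succAbove_lt_iff_castSucc_lt _ _).1 hpq),
      Fin.val_castSucc]
  have hsub : (A.updateRow (j.succAbove i') (Pi.single (q.succAbove p') 1)).submatrix
      j.succAbove q.succAbove =
      (A.submatrix j.succAbove q.succAbove).updateRow i' (Pi.single p' 1) := by
    ext a b
    simp [Matrix.updateRow_apply, Pi.single_apply]
  have hminor : complMinor2 A (j.succAbove i') j (q.succAbove p') q hij.ne hpq.ne =
      ((A.submatrix j.succAbove q.succAbove).submatrix i'.succAbove p'.succAbove).det := by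
    rw [Matrix.submatrix_submatrix, ← Finset.orderEmbOfFin_compl_pair j i',
      ← Finset.orderEmbOfFin_compl_pair q p']
    rfl
  rw [Matrix.det_updateRow_single_one, hsub, Matrix.det_updateRow_single_one, hminor, hi, hp]
  ring

/-- The three-term Plücker relation for the complementary minors `m(p,q)` of a square
matrix `A`, obtained by deleting rows `i < j` and columns `p < q`. -/
theorem complementary_minor_plucker {R : Type*} [CommRing R] {n : ℕ} (hn : 4 ≤ n)
    (A : Matrix (Fin n) (Fin n) R) (i j k l s r : Fin n)
    (hij : i < j) (hkl : k < l) (hls : l < s) (hsr : s < r) :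
    complMinor2 A i j k l hij.ne hkl.ne * complMinor2 A i j s r hij.ne hsr.ne
      - complMinor2 A i j k s hij.ne (hkl.trans hls).ne
        * complMinor2 A i j l r hij.ne (hls.trans hsr).ne
      + complMinor2 A i j k r hij.ne ((hkl.trans hls).trans hsr).ne
        * complMinor2 A i j l s hij.ne hls.ne = 0 := by
  have key := A.det_updateRow_updateRow_mul hij.ne
    (Pi.single k 1) (Pi.single l 1) (Pi.single s 1) (Pi.single r 1)
  rw [A.det_updateRow_updateRow_swap hij.ne (Pi.single s 1) (Pi.single l 1),
    det_updateRow_single_updateRow_single A hij hkl,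
    det_updateRow_single_updateRow_single A hij hsr,
    det_updateRow_single_updateRow_single A hij hls,
    det_updateRow_single_updateRow_single A hij ((hkl.trans hls).trans hsr),
    det_updateRow_single_updateRow_single A hij (hkl.trans hls),
    det_updateRow_single_updateRow_single A hij (hls.trans hsr)] at key
  have hsign : ((-1 : R) ^ (i + j + k + l + i + j + s + r : ℕ)) *
      (-1) ^ (i + j + k + l + i + j + s + r : ℕ) = 1 := by
    rw [← mul_pow]
    simp
  linear_combination (-1 : R) ^ (i + j + k + l + i + j + s + r : ℕ) * key -
    (complMinor2 A i j k l hij.ne hkl.ne * complMinor2 A i j s r hij.ne hsr.ne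
      - complMinor2 A i j k s hij.ne (hkl.trans hls).ne
        * complMinor2 A i j l r hij.ne (hls.trans hsr).ne
      + complMinor2 A i j k r hij.ne ((hkl.trans hls).trans hsr).ne
        * complMinor2 A i j l s hij.ne hls.ne) * hsign
end

section
/- Let R be a commutative ring, let n ≥ 2, and let A be an n × n matrix over R. For indices p, q, let M_{pq} denote the determinant of the (n − 1) × (n − 1) matrix obtained from A by deleting row p and column q, and for p ≠ q let M^{pq}_{pq} denote the determinant of the (n − 2) × (n − 2) matrix obtained from A by deleting rows p and q and columns p and q. Then for all i ≠ j, M_{ii}·M_{jj} − M_{ij}·M_{ji} = M^{ij}_{ij} · det A (the Jacobi identity, also known as the Desnanot–Jacobi identity). -/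
/-- The `(p,q)`-minor of `A`: the determinant of the `(n - 1) × (n - 1)` matrix obtained
from `A` by deleting row `p` and column `q` (remaining indices in increasing order). -/
noncomputable def minor1 {R : Type*} [CommRing R] {n : ℕ}
    (A : Matrix (Fin n) (Fin n) R) (p q : Fin n) : R :=
  Matrix.det (A.submatrix
    (fun t : Fin (n - 1) => ({p}ᶜ : Finset (Fin n)).orderEmbOfFin
      (by rw [Finset.card_compl, Finset.card_singleton, Fintype.card_fin]) t)
    (fun t : Fin (n - 1) => ({q}ᶜ : Finset (Fin n)).orderEmbOfFin
      (by rw [Finset.card_compl, Finset.card_singleton, Fintype.card_fin]) t))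

/-- The determinant of the `(n - 2) × (n - 2)` matrix obtained from `A` by deleting
rows `i`, `j` and columns `p`, `q` (remaining indices in increasing order). -/
noncomputable def minor2 {R : Type*} [CommRing R] {n : ℕ}
    (A : Matrix (Fin n) (Fin n) R) (i j p q : Fin n) (hij : i ≠ j) (hpq : p ≠ q) : R :=
  Matrix.det (A.submatrix
    (fun t : Fin (n - 2) => ({i, j}ᶜ : Finset (Fin n)).orderEmbOfFin
      (by rw [Finset.card_compl, Finset.card_pair hij, Fintype.card_fin]) t)
    (fun t : Fin (n - 2) => ({p, q}ᶜ : Finset (Fin n)).orderEmbOfFin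
      (by rw [Finset.card_compl, Finset.card_pair hpq, Fintype.card_fin]) t))

namespace Matrix

variable {R m o : Type*} [CommRing R] [Fintype m] [DecidableEq m]
  [Fintype o] [DecidableEq o]

/-- Jacobi's complementary minor formula for a block of the adjugate, multiplied by `M.det`. -/
theorem det_mul_det_adjugate_toBlocks₂₂ (M : Matrix (m ⊕ o) (m ⊕ o) R) :
    M.det * M.adjugate.toBlocks₂₂.det = M.toBlocks₁₁.det * M.det ^ Fintype.card o := by
  have hadj := M.mul_adjugate
  rw [← M.fromBlocks_toBlocks, ← (fromBlocks _ _ _ _).adjugate.fromBlocks_toBlocks,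
    fromBlocks_multiply, M.fromBlocks_toBlocks, ← fromBlocks_one, fromBlocks_smul,
    fromBlocks_inj] at hadj
  obtain ⟨-, h₁₂, -, h₂₂⟩ := hadj
  have hmul : M * fromBlocks 1 M.adjugate.toBlocks₁₂ 0 M.adjugate.toBlocks₂₂ =
      fromBlocks M.toBlocks₁₁ 0 M.toBlocks₂₁ (M.det • 1) := by
    conv_lhs => rw [← M.fromBlocks_toBlocks, fromBlocks_multiply, M.fromBlocks_toBlocks]
    simp [h₁₂, h₂₂]
  simpa [det_fromBlocks_zero₂₁, det_fromBlocks_zero₁₂, det_smul] using congrArg det hmul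

theorem det_adjugate_toBlocks₂₂_fin_two (M : Matrix (m ⊕ Fin 2) (m ⊕ Fin 2) R) :
    M.adjugate.toBlocks₂₂.det = M.toBlocks₁₁.det * M.det := by
  let X := mvPolynomialX (m ⊕ Fin 2) (m ⊕ Fin 2) ℤ
  have hX : X.adjugate.toBlocks₂₂.det = X.toBlocks₁₁.det * X.det := by
    apply mul_left_cancel₀ (det_mvPolynomialX_ne_zero (m ⊕ Fin 2) ℤ)
    rw [det_mul_det_adjugate_toBlocks₂₂, Fintype.card_fin]
    ring
  let f : MvPolynomial ((m ⊕ Fin 2) × (m ⊕ Fin 2)) ℤ →+* R :=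
    (MvPolynomial.aeval fun p : (m ⊕ Fin 2) × (m ⊕ Fin 2) => M p.1 p.2).toRingHom
  have hf : f.mapMatrix X = M := mvPolynomialX_mapMatrix_aeval ℤ M
  have hadj : f.mapMatrix X.adjugate.toBlocks₂₂ = M.adjugate.toBlocks₂₂ :=
    congrArg toBlocks₂₂ ((f.map_adjugate X).trans (congrArg adjugate hf))
  have hblock : f.mapMatrix X.toBlocks₁₁ = M.toBlocks₁₁ := congrArg toBlocks₁₁ hf
  simpa only [map_mul, f.map_det, hadj, hblock, hf] using congrArg f hX

end Matrix

theorem adjugate_apply_eq_minor1 {R : Type*} [CommRing R] {n : ℕ}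
    (A : Matrix (Fin n) (Fin n) R) (p q : Fin n) :
    A.adjugate p q = (-1) ^ (q + p : ℕ) * minor1 A q p := by
  cases n with
  | zero => exact p.elim0
  | succ n =>
    rw [Matrix.adjugate_fin_succ_eq_det_submatrix, minor1]
    simp only [Finset.orderEmbOfFin_compl_singleton_apply]
    rfl

/-- The Jacobi (Desnanot–Jacobi) identity:
`M_{ii}·M_{jj} − M_{ij}·M_{ji} = M^{ij}_{ij} · det A`. -/
theorem jacobi_identity {R : Type*} [CommRing R] {n : ℕ} (hn : 2 ≤ n)
    (A : Matrix (Fin n) (Fin n) R) (i j : Fin n) (hij : i ≠ j) :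
    minor1 A i i * minor1 A j j - minor1 A i j * minor1 A j i
      = minor2 A i j i j hij hij * A.det := by
  have hcard : ({i, j}ᶜ : Finset (Fin n)).card = n - 2 := by
    rw [Finset.card_compl, Finset.card_pair hij, Fintype.card_fin]
  let c := ({i, j}ᶜ : Finset (Fin n)).orderEmbOfFin hcard
  have hc : ∀ t, c t ≠ i ∧ c t ≠ j := fun t => by
    have ht := Finset.orderEmbOfFin_mem ({i, j}ᶜ : Finset (Fin n)) hcard t
    rwa [Finset.mem_compl, Finset.mem_insert, Finset.mem_singleton, not_or] at ht
  have he : Function.Injective (Sum.elim c ![i, j]) := by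
    refine c.injective.sumElim ?_ ?_
    · intro a b
      fin_cases a <;> fin_cases b <;> simp [hij, hij.symm]
    · intro t b
      fin_cases b
      exacts [(hc t).1, (hc t).2]
  let e : Fin (n - 2) ⊕ Fin 2 ≃ Fin n := Equiv.ofBijective _
    ((Fintype.bijective_iff_injective_and_card _).2 ⟨he, by simp; omega⟩)
  have key := (A.submatrix e e).det_adjugate_toBlocks₂₂_fin_two
  rw [Matrix.det_submatrix_equiv_self, Matrix.adjugate_submatrix_equiv_self,
    Matrix.det_fin_two] at key
  change A.adjugate i i * A.adjugate j j - A.adjugate i j * A.adjugate j i =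
    minor2 A i j i j hij hij * A.det at key
  rw [← key]
  simp only [adjugate_apply_eq_minor1]
  have hsign : ((-1 : R) ^ (j + i : ℕ)) * (-1) ^ (i + j : ℕ) = 1 := by
    rw [add_comm (j : ℕ), ← mul_pow]; simp
  have hi (k : ℕ) : (-1 : R) ^ (k + k) = 1 := Even.neg_one_pow ⟨k, rfl⟩
  rw [hi, hi]
  linear_combination minor1 A i j * minor1 A j i * hsign
end
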